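/- For every even-dimension input, the divider layer recovers the DFTs of the even- and odd-indexed subsequences: for every x ∈ ℂ^{2N}, Div_[2N](F_{2N}(x)) = (F_N(x_E), F_N(x_O)), where x_E and x_O are the even- and odd-indexed subsequences of x. -/

import Mathlib

open Complex Finset

/-- The discrete Fourier transform `F_N : ℂ^N → ℂ^N`,
`F_N(x)_k = ∑_j x_j ω_N^{jk}` with `ω_N = exp(-2πi/N)`. -/
noncomputable def dft (N : ℕ) (x : Fin N → ℂ) : Fin N → ℂ :=
  fun k => ∑ j : Fin N, x j * Complex.exp (-2 * Real.pi * Complex.I / N) ^ ((j : ℕ) * (k : ℕ))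

/-- The even-indexed subsequence `x_E = (x_0, x_2, …, x_{2N−2})` of `x ∈ ℂ^{2N}`. -/
def evenPart {N : ℕ} (x : Fin (2 * N) → ℂ) : Fin N → ℂ :=
  fun k => x ⟨2 * k.1, by have := k.2; omega⟩

/-- The odd-indexed subsequence `x_O = (x_1, x_3, …, x_{2N−1})` of `x ∈ ℂ^{2N}`. -/
def oddPart {N : ℕ} (x : Fin (2 * N) → ℂ) : Fin N → ℂ :=
  fun k => x ⟨2 * k.1 + 1, by have := k.2; omega⟩

/-- The divider layer `Div_[2N] : ℂ^{2N} → ℂ^N × ℂ^N`, with first output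
`(1/2)(x_k + x_{k+N})` and second output `(ω_{2N}^{−k}/2)(x_k − x_{k+N})`. -/
noncomputable def divLayer (N : ℕ) (x : Fin (2 * N) → ℂ) : (Fin N → ℂ) × (Fin N → ℂ) :=
  (fun k => (x ⟨k.1, by have := k.2; omega⟩ + x ⟨k.1 + N, by have := k.2; omega⟩) / 2,
   fun k => (Complex.exp (-2 * Real.pi * Complex.I / (2 * N : ℕ)))⁻¹ ^ (k : ℕ) / 2 *
     (x ⟨k.1, by have := k.2; omega⟩ - x ⟨k.1 + N, by have := k.2; omega⟩))

/-- A sum over `Fin (2 * N)` splits into its even- and odd-indexed parts. -/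
theorem sum_eq_sum_evenPart_add_oddPart {N : ℕ} (f : Fin (2 * N) → ℂ) :
    ∑ j, f j = ∑ j, (evenPart f j + oddPart f j) := by
  induction N with
  | zero => rfl
  | succ n ih =>
    rw [Fin.sum_univ_castSucc (n := n)]
    change ∑ j : Fin (2 * n + 1 + 1), f j = _
    rw [Fin.sum_univ_castSucc, Fin.sum_univ_castSucc, ih, add_assoc]
    rfl

theorem exp_neg_two_pi_I_div_two_mul_pow_two (N : ℕ) :
    Complex.exp (-2 * Real.pi * Complex.I / (2 * N : ℕ)) ^ 2 =
      Complex.exp (-2 * Real.pi * Complex.I / N) := by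
  rw [← Complex.exp_nat_mul]
  congr 1
  push_cast
  ring

theorem exp_neg_two_pi_I_div_two_mul_pow_self {N : ℕ} (hN : N ≠ 0) :
    Complex.exp (-2 * Real.pi * Complex.I / (2 * N : ℕ)) ^ N = -1 := by
  have hN' : (N : ℂ) ≠ 0 := Nat.cast_ne_zero.mpr hN
  rw [← Complex.exp_nat_mul, ← Complex.exp_neg_pi_mul_I]
  congr 1
  push_cast
  field_simp

/-- The radix-2 butterfly: output `k` of the transform of length `2 * N`. -/
theorem dft_two_mul_apply_of_lt {N : ℕ} (x : Fin (2 * N) → ℂ) (k : Fin N) (hk : k.1 < 2 * N) :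
    dft (2 * N) x ⟨k, hk⟩ = dft N (evenPart x) k +
      Complex.exp (-2 * Real.pi * Complex.I / (2 * N : ℕ)) ^ (k : ℕ) * dft N (oddPart x) k := by
  simp only [dft]
  rw [sum_eq_sum_evenPart_add_oddPart, Finset.mul_sum, ← Finset.sum_add_distrib]
  refine Finset.sum_congr rfl fun j _ => ?_
  simp only [evenPart, oddPart, ← exp_neg_two_pi_I_div_two_mul_pow_two N]
  ring

/-- The radix-2 butterfly: output `k + N` of the transform of length `2 * N`. -/
theorem dft_two_mul_apply_add {N : ℕ} (x : Fin (2 * N) → ℂ) (k : Fin N) (hk : k.1 + N < 2 * N) :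
    dft (2 * N) x ⟨k + N, hk⟩ = dft N (evenPart x) k -
      Complex.exp (-2 * Real.pi * Complex.I / (2 * N : ℕ)) ^ (k : ℕ) * dft N (oddPart x) k := by
  have hw := exp_neg_two_pi_I_div_two_mul_pow_self (N := N) (by have := k.2; omega)
  simp only [dft]
  rw [sum_eq_sum_evenPart_add_oddPart, Finset.mul_sum, ← Finset.sum_sub_distrib]
  refine Finset.sum_congr rfl fun j _ => ?_
  simp only [evenPart, oddPart, ← exp_neg_two_pi_I_div_two_mul_pow_two N]
  generalize Complex.exp (-2 * Real.pi * Complex.I / (2 * N : ℕ)) = w at hw ⊢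
  have he : w ^ (2 * (j : ℕ) * (k + N)) = (w ^ 2) ^ ((j : ℕ) * k) := by
    rw [show 2 * (j : ℕ) * (k + N) = 2 * (j * k) + N * (2 * j) by ring, pow_add, pow_mul w N, hw,
      (even_two_mul _).neg_one_pow, mul_one, pow_mul]
  have ho : w ^ ((2 * (j : ℕ) + 1) * (k + N)) = -(w ^ (k : ℕ) * (w ^ 2) ^ ((j : ℕ) * k)) := by
    rw [add_mul, pow_add, he, one_mul, pow_add, hw]
    ring
  rw [he, ho]
  ring

/-- the divider layer recovers the DFTs of the even- and odd-indexed
subsequences: `Div_[2N](F_{2N}(x)) = (F_N(x_E), F_N(x_O))` for every `x ∈ ℂ^{2N}`. -/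
theorem divLayer_dft (N : ℕ) (hN : 0 < N) (x : Fin (2 * N) → ℂ) :
    divLayer N (dft (2 * N) x) = (dft N (evenPart x), dft N (oddPart x)) := by
  refine Prod.ext (funext fun k => ?_) (funext fun k => ?_)
  · simp only [divLayer, dft_two_mul_apply_of_lt, dft_two_mul_apply_add]
    ring
  · have hw : Complex.exp (-2 * Real.pi * Complex.I / (2 * N : ℕ)) ^ (k : ℕ) ≠ 0 :=
      pow_ne_zero _ (Complex.exp_ne_zero _)
    simp only [divLayer, dft_two_mul_apply_of_lt, dft_two_mul_apply_add, inv_pow]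
    generalize Complex.exp (-2 * Real.pi * Complex.I / (2 * N : ℕ)) ^ (k : ℕ) = w at hw ⊢
    field_simp
    ring
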